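/- Let s(n) be the little Schröder numbers (s(0)=1, s(1)=1, s(2)=3, s(3)=11, ...). Then det((x·s(i+j) − s(i+j+1))_{i,j=0}^{n}) / det((s(i+j))_{i,j=0}^{n}) = Σ_{k=0}^{n+1} (−1)^{n+1−k} x^k Σ_{j=0}^{n+1−k} 2^j binom(n+1−j, k) binom(k+j−1, j). -/

import Mathlib

open Polynomial Finset

/-- The monic orthogonal polynomials of the little Schröder moment functional. -/
noncomputable def schroederPoly : ℕ → Polynomial ℚ
  | 0 => 1
  | 1 => X - 1
  | N + 2 => (X - 3) * schroederPoly (N + 1) - 2 * schroederPoly N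

/-- The linear functional on polynomials with moments `s`. -/
noncomputable def momentFunctional (s : ℕ → ℚ) : Polynomial ℚ →ₗ[ℚ] ℚ :=
  (Polynomial.basisMonomials ℚ).constr ℚ s

lemma momentFunctional_X_pow (s : ℕ → ℚ) (k : ℕ) : momentFunctional s (X ^ k) = s k := by
  have h := (Polynomial.basisMonomials ℚ).constr_basis ℚ s k
  simpa [momentFunctional, Polynomial.monomial_one_right_eq_X_pow] using h

lemma schroederPoly_monic_natDegree (N : ℕ) :
    (schroederPoly N).Monic ∧ (schroederPoly N).natDegree = N := by
  induction N using Nat.twoStepInduction with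
  | zero => simp [schroederPoly]
  | one =>
    rw [schroederPoly, ← C_1]
    exact ⟨monic_X_sub_C 1, natDegree_X_sub_C 1⟩
  | more N ih₀ ih₁ =>
    have hX : (X - 3 : Polynomial ℚ) = X - C 3 := rfl
    have hm : ((X - 3) * schroederPoly (N + 1)).Monic := by
      rw [hX]
      exact (monic_X_sub_C 3).mul ih₁.1
    have hd : ((X - 3) * schroederPoly (N + 1)).natDegree = N + 2 := by
      rw [hX, (monic_X_sub_C 3).natDegree_mul ih₁.1, natDegree_X_sub_C, ih₁.2]
      ring
    have hlt : (2 * schroederPoly N).natDegree < ((X - 3) * schroederPoly (N + 1)).natDegree := by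
      have h := natDegree_C_mul_le (2 : ℚ) (schroederPoly N)
      rw [ih₀.2] at h
      rw [hd]
      exact lt_of_le_of_lt h (by lia)
    rw [schroederPoly]
    exact ⟨hm.sub_of_left (degree_lt_degree hlt),
      by rw [natDegree_sub_eq_left_of_natDegree_lt hlt, hd]⟩

/-- If `f` is monic of degree `m` and annihilated by the moment functional against all lower powers
of `X`, then the determinant of the linear Hankel pencil is a multiple of `f`. -/
lemma det_hankel_pencil (s : ℕ → ℚ) (f : Polynomial ℚ) (hf : f.Monic) (m : ℕ)
    (hm : f.natDegree = m) (horth : ∀ i < m, momentFunctional s (X ^ i * f) = 0) :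
    (Matrix.of fun i j : Fin m => C (s ((i : ℕ) + j)) * X - C (s ((i : ℕ) + j + 1))).det
      = C (Matrix.of fun i j : Fin m => s ((i : ℕ) + j)).det * f := by
  subst hm
  let pb := AdjoinRoot.powerBasis hf.ne_zero
  have hmin : minpoly ℚ pb.gen = f := AdjoinRoot.minpoly_powerBasis_gen_of_monic hf
  let M : Matrix (Fin f.natDegree) (Fin f.natDegree) ℚ := Algebra.leftMulMatrix pb.basis pb.gen
  have hchar : M.charpoly = f := (charpoly_leftMulMatrix pb).trans hmin
  have hM (i j : Fin f.natDegree) : M i j = if (j : ℕ) + 1 = f.natDegree then -f.coeff i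
      else if (i : ℕ) = j + 1 then 1 else 0 := by
    have h := congrFun₂ pb.leftMulMatrix i j
    simp only [pb.minpolyGen_eq, hmin] at h
    exact h
  have hmul (i j : Fin f.natDegree) :
      ∑ k : Fin f.natDegree, s ((i : ℕ) + k) * M k j = s ((i : ℕ) + j + 1) := by
    simp only [hM]
    by_cases hj : (j : ℕ) + 1 = f.natDegree
    all_goals simp only [hj, if_true, if_false]
    · have h : momentFunctional s (X ^ (i : ℕ)
          * ∑ k ∈ range (f.natDegree + 1), C (f.coeff k) * X ^ k) = 0 := by
        rw [← f.as_sum_range_C_mul_X_pow]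
        exact horth i i.2
      rw [sum_range_succ, mul_add, map_add, mul_sum, map_sum, hf.coeff_natDegree] at h
      have hk (k : ℕ) (c : ℚ) :
          momentFunctional s (X ^ (i : ℕ) * (C c * X ^ k)) = c * s (i + k) := by
        rw [show (X : Polynomial ℚ) ^ (i : ℕ) * (C c * X ^ k) = c • X ^ (i + k : ℕ) by
          rw [smul_eq_C_mul]; ring, map_smul, momentFunctional_X_pow, smul_eq_mul]
      simp only [hk] at h
      rw [Fin.sum_univ_eq_sum_range (fun k => s ((i : ℕ) + k) * -f.coeff k), add_assoc, hj]
      simp only [mul_neg, sum_neg_distrib]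
      simp only [mul_comm (f.coeff _)] at h
      linarith
    · have hlt : (j : ℕ) + 1 < f.natDegree := by have := j.2; lia
      rw [sum_eq_single (⟨j + 1, hlt⟩ : Fin f.natDegree)]
      · simp [add_assoc]
      · intro b _ hb
        rw [if_neg (fun h => hb (Fin.ext h)), mul_zero]
      · simp
  have hprod : (Matrix.of fun i j : Fin f.natDegree =>
      C (s ((i : ℕ) + j)) * X - C (s ((i : ℕ) + j + 1)))
      = (Matrix.of fun i j : Fin f.natDegree => s ((i : ℕ) + j)).map C * M.charmatrix := by
    ext1 i j
    rw [Matrix.charmatrix, mul_sub, Matrix.sub_apply, Matrix.mul_apply, Matrix.mul_apply]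
    simp only [Matrix.map_apply, Matrix.of_apply, Matrix.scalar_apply, RingHom.mapMatrix_apply,
      ← C_mul, ← map_sum, hmul]
    simp [Matrix.diagonal_apply]
  rw [hprod, Matrix.det_mul, ← Matrix.charpoly, hchar, RingHom.map_det]
  rfl

namespace PowerSeries

/-- A series whose coefficients satisfy the little Schröder recurrence is a root of the quadratic
equation of the little Schröder generating function. -/
lemma littleSchroeder_quadratic (s : ℕ → ℚ) (hs0 : s 0 = 1) (hs1 : s 1 = 1)
    (hs : ∀ m : ℕ, (m + 3 : ℚ) * s (m + 2) = (6 * m + 9) * s (m + 1) - m * s m) :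
    2 * X * mk s ^ 2 - (1 + X) * mk s + 1 = 0 := by
  set g : ℚ⟦X⟧ := mk s with hg
  set Δ : ℚ⟦X⟧ := 1 - 6 * X + X ^ 2 with hΔ
  have h3 : (3 : ℚ⟦X⟧) = C 3 := rfl
  have h4 : (4 : ℚ⟦X⟧) = C 4 := rfl
  have h6 : (6 : ℚ⟦X⟧) = C 6 := rfl
  have hode : Δ * d⁄dX ℚ (X * g) = (X - 3) * (X * g) + 1 - X := by
    have e1 : Δ * d⁄dX ℚ (X * g) = d⁄dX ℚ (X * g) - C 6 * (X * d⁄dX ℚ (X * g))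
        + X * (X * d⁄dX ℚ (X * g)) := by rw [← h6, hΔ]; ring
    have e2 : (X - 3) * (X * g) + 1 - X = X * (X * g) - C 3 * (X * g) + 1 - X := by
      rw [← h3]; ring
    rw [e1, e2]
    ext n
    match n with
    | 0 => simp [hg, hs0]
    | 1 =>
      simp only [map_add, map_sub, coeff_C_mul, coeff_derivative, coeff_succ_X_mul,
        coeff_zero_X_mul, coeff_one_X, coeff_one, hg, coeff_mk, hs0, hs1]
      norm_num [coeff_succ_X_mul, coeff_derivative, coeff_X, hs0, hs1]
    | n + 2 =>
      simp only [map_add, map_sub, coeff_C_mul, coeff_derivative, coeff_succ_X_mul,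
        coeff_X, coeff_one, hg, coeff_mk]
      have := hs n
      push_cast
      simp
      linarith
  set w : ℚ⟦X⟧ := 4 * (X * g) - (1 + X) with hw
  have hdw : d⁄dX ℚ w = 4 * d⁄dX ℚ (X * g) - 1 := by
    rw [hw, h4, map_sub, map_add, Derivation.leibniz (d⁄dX ℚ) (C 4)]
    simp
  have hdΔ : d⁄dX ℚ Δ = 2 * X - 6 := by
    rw [hΔ, h6, map_add, map_sub, Derivation.leibniz (d⁄dX ℚ) (C 6), derivative_pow]
    simp
    ring
  have hwode : Δ * d⁄dX ℚ w = (X - 3) * w := by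
    rw [hdw, hw]
    linear_combination 4 * hode - hΔ
  have hΔ0 : constantCoeff Δ ≠ 0 := by simp [hΔ]
  have hinv : Δ * Δ⁻¹ = 1 := PowerSeries.mul_inv_cancel _ hΔ0
  have hconst : w ^ 2 * Δ⁻¹ = 1 := by
    apply derivative.ext
    · rw [Derivation.leibniz, derivative_inv', derivative_pow, derivative_one, hdΔ]
      simp only [smul_eq_mul]
      have : Δ⁻¹ ^ 2 * (Δ * d⁄dX ℚ w * (2 * w) - w ^ 2 * (2 * X - 6)) = 0 := by
        rw [hwode]; ring
      push_cast
      linear_combination this - Δ⁻¹ * 2 * w * d⁄dX ℚ w * hinv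
    · simp [hw, hΔ]
  have hsq : w ^ 2 = Δ := by linear_combination Δ * hconst - w ^ 2 * hinv
  have h8' : (8 : ℚ⟦X⟧) ≠ 0 := by
    rw [show (8 : ℚ⟦X⟧) = C 8 from rfl]
    simp
  have h8 : (8 * X : ℚ⟦X⟧) ≠ 0 := mul_ne_zero h8' X_ne_zero
  apply (mul_eq_zero.mp _).resolve_left h8
  rw [hw, hΔ] at hsq
  linear_combination hsq

end PowerSeries

lemma momentFunctional_schroederPoly (s : ℕ → ℚ)
    (hq : 2 * PowerSeries.X * PowerSeries.mk s ^ 2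
      - (1 + PowerSeries.X) * PowerSeries.mk s + 1 = 0) (N n : ℕ) :
    momentFunctional s (X ^ n * schroederPoly N)
      = PowerSeries.coeff n (PowerSeries.mk s * (2 * (PowerSeries.mk s - 1)) ^ N) := by
  have h2 : (2 : PowerSeries ℚ) = PowerSeries.C 2 := rfl
  have h3 : (3 : PowerSeries ℚ) = PowerSeries.C 3 := rfl
  set g := PowerSeries.mk s with hg
  induction N using Nat.twoStepInduction generalizing n with
  | zero => simp [schroederPoly, momentFunctional_X_pow, hg]
  | one =>
    have key : PowerSeries.X * (g * (2 * (g - 1)) ^ 1) = g - 1 - PowerSeries.X * g := by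
      linear_combination hq
    rw [← PowerSeries.coeff_succ_X_mul, key, schroederPoly, mul_sub, mul_one, ← pow_succ, map_sub,
      momentFunctional_X_pow, momentFunctional_X_pow, map_sub, map_sub,
      PowerSeries.coeff_succ_X_mul, PowerSeries.coeff_one, hg]
    simp
  | more N ih₀ ih₁ =>
    have key : PowerSeries.X * (g * (2 * (g - 1)) ^ (N + 2)) = g * (2 * (g - 1)) ^ (N + 1)
        - PowerSeries.C 3 * (PowerSeries.X * (g * (2 * (g - 1)) ^ (N + 1)))
        - PowerSeries.C 2 * (PowerSeries.X * (g * (2 * (g - 1)) ^ N)) := by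
      rw [← h2, ← h3]
      linear_combination 2 * g * (2 * (g - 1)) ^ N * hq
    have hrec : X ^ n * schroederPoly (N + 2) = X ^ (n + 1) * schroederPoly (N + 1)
        - (3 : ℚ) • (X ^ n * schroederPoly (N + 1)) - (2 : ℚ) • (X ^ n * schroederPoly N) := by
      rw [schroederPoly, smul_eq_C_mul, smul_eq_C_mul, show (C 3 : Polynomial ℚ) = 3 from rfl,
        show (C 2 : Polynomial ℚ) = 2 from rfl]
      ring
    rw [← PowerSeries.coeff_succ_X_mul, key, hrec]
    simp only [map_sub, map_smul, ih₀, ih₁, PowerSeries.coeff_C_mul,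
      PowerSeries.coeff_succ_X_mul, smul_eq_mul]

lemma momentFunctional_schroederPoly_eq_zero (s : ℕ → ℚ) (hs0 : s 0 = 1)
    (hq : 2 * PowerSeries.X * PowerSeries.mk s ^ 2
      - (1 + PowerSeries.X) * PowerSeries.mk s + 1 = 0) {N n : ℕ} (hn : n < N) :
    momentFunctional s (X ^ n * schroederPoly N) = 0 := by
  rw [momentFunctional_schroederPoly s hq]
  have hdvd : PowerSeries.X ∣ 2 * (PowerSeries.mk s - 1) := by
    apply Dvd.dvd.mul_left
    rw [PowerSeries.X_dvd_iff, map_sub, map_one, ← PowerSeries.coeff_zero_eq_constantCoeff_apply,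
      PowerSeries.coeff_mk, hs0, sub_self]
  exact PowerSeries.X_pow_dvd_iff.mp ((pow_dvd_pow_of_dvd hdvd N).mul_left _) n hn

/-- The generating function of the unsigned `k`-th coefficients of `schroederPoly`. -/
noncomputable def schroederCoeffSeries (k : ℕ) : PowerSeries ℚ :=
  PowerSeries.mk (fun N => (N.choose k : ℚ))
    * PowerSeries.mk (fun j => (2 ^ j * (k + j - 1).choose j : ℚ))

lemma schroederCoeffSeries_zero : schroederCoeffSeries 0 * (1 - PowerSeries.X) = 1 := by
  have h : PowerSeries.mk (fun j => (2 ^ j * (0 + j - 1).choose j : ℚ)) = 1 := by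
    ext n
    rcases n with _ | n
    · simp
    · simp [PowerSeries.coeff_one]
  rw [schroederCoeffSeries, h, mul_one]
  simp only [Nat.choose_zero_right, Nat.cast_one]
  exact PowerSeries.mk_one_mul_one_sub_eq_one ℚ

lemma schroederCoeffSeries_succ (k : ℕ) :
    schroederCoeffSeries (k + 1) * ((1 - PowerSeries.X) * (1 - 2 * PowerSeries.X))
      = PowerSeries.X * schroederCoeffSeries k := by
  have hB : PowerSeries.mk (fun N => (N.choose (k + 1) : ℚ)) * (1 - PowerSeries.X)
      = PowerSeries.X * PowerSeries.mk (fun N => (N.choose k : ℚ)) := by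
    rw [mul_sub, mul_one, mul_comm _ PowerSeries.X]
    ext n
    rcases n with _ | n
    · simp
    · simp only [map_sub, PowerSeries.coeff_succ_X_mul, PowerSeries.coeff_mk,
        Nat.choose_succ_succ' n k]
      push_cast
      ring
  have hD : PowerSeries.mk (fun j => (2 ^ j * (k + 1 + j - 1).choose j : ℚ))
      * (1 - 2 * PowerSeries.X)
      = PowerSeries.mk (fun j => (2 ^ j * (k + j - 1).choose j : ℚ)) := by
    have h2 : (2 : PowerSeries ℚ) = PowerSeries.C 2 := rfl
    rw [mul_sub, mul_one, mul_left_comm, mul_comm _ PowerSeries.X, h2]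
    ext n
    rcases n with _ | n
    · simp
    · simp only [map_sub, PowerSeries.coeff_succ_X_mul, PowerSeries.coeff_mk,
        PowerSeries.coeff_C_mul, show k + 1 + (n + 1) - 1 = k + n + 1 by lia,
        show k + 1 + n - 1 = k + n by lia, show k + (n + 1) - 1 = k + n by lia,
        Nat.choose_succ_succ' (k + n) n]
      push_cast
      ring
  rw [schroederCoeffSeries, schroederCoeffSeries]
  linear_combination (PowerSeries.X * PowerSeries.mk (fun N => (N.choose k : ℚ))) * hD
    + PowerSeries.mk (fun j => (2 ^ j * (k + 1 + j - 1).choose j : ℚ))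
      * (1 - 2 * PowerSeries.X) * hB

lemma coeff_schroederCoeffSeries {N k : ℕ} (hk : k ≤ N) :
    PowerSeries.coeff N (schroederCoeffSeries k)
      = ((∑ j ∈ range (N + 1 - k), 2 ^ j * (N - j).choose k * (k + j - 1).choose j : ℕ) : ℚ) := by
  rw [schroederCoeffSeries, mul_comm, PowerSeries.coeff_mul,
    Nat.sum_antidiagonal_eq_sum_range_succ_mk]
  push_cast
  symm
  simp only [PowerSeries.coeff_mk]
  rw [← sum_subset (range_subset_range.mpr (show N + 1 - k ≤ N.succ by lia))]
  · exact sum_congr rfl fun j _ => by ring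
  · intro j _ hj
    rw [mem_range, not_lt] at hj
    rw [Nat.choose_eq_zero_of_lt (show N - j < k by grind)]
    simp

lemma coeff_schroederPoly (N k : ℕ) :
    (schroederPoly N).coeff k
      = (-1) ^ (N + k) * PowerSeries.coeff N (schroederCoeffSeries k) := by
  have h2 : (2 : PowerSeries ℚ) = PowerSeries.C 2 := rfl
  have h3 : (3 : PowerSeries ℚ) = PowerSeries.C 3 := rfl
  induction N using Nat.twoStepInduction generalizing k with
  | zero =>
    rcases k with _ | k <;>
      simp [schroederPoly, schroederCoeffSeries, PowerSeries.coeff_mul, Polynomial.coeff_one,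
        -PowerSeries.coeff_zero_eq_constantCoeff]
  | one =>
    rcases k with _ | _ | k <;>
      simp [schroederPoly, schroederCoeffSeries, PowerSeries.coeff_mul, Polynomial.coeff_one,
        Polynomial.coeff_X, Nat.antidiagonal_succ, Nat.choose_succ_succ']
  | more N ih₀ ih₁ =>
    have hrec : schroederPoly (N + 2) = X * schroederPoly (N + 1)
        - C 3 * schroederPoly (N + 1) - C 2 * schroederPoly N := by
      rw [schroederPoly, show (C 3 : Polynomial ℚ) = 3 from rfl,
        show (C 2 : Polynomial ℚ) = 2 from rfl]
      ring
    rw [hrec]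
    rcases k with _ | k
    · have h : schroederCoeffSeries 0
          = 1 + PowerSeries.X * schroederCoeffSeries 0 := by
        linear_combination schroederCoeffSeries_zero
      have hN (n : ℕ) : PowerSeries.coeff (n + 1) (schroederCoeffSeries 0)
          = PowerSeries.coeff n (schroederCoeffSeries 0) := by
        conv_lhs => rw [h]
        simp [PowerSeries.coeff_one, PowerSeries.coeff_succ_X_mul]
      rw [coeff_sub, coeff_sub, coeff_C_mul, coeff_C_mul, coeff_X_mul_zero, ih₀, ih₁]
      simp only [hN]
      ring
    · have h : schroederCoeffSeries (k + 1) = PowerSeries.X * schroederCoeffSeries k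
          + PowerSeries.C 3 * (PowerSeries.X * schroederCoeffSeries (k + 1))
          - PowerSeries.C 2 * (PowerSeries.X * (PowerSeries.X * schroederCoeffSeries (k + 1))) := by
        rw [← h2, ← h3]
        linear_combination schroederCoeffSeries_succ k
      have hN := congrArg (PowerSeries.coeff (N + 2)) h
      simp only [map_sub, map_add, PowerSeries.coeff_C_mul, PowerSeries.coeff_succ_X_mul] at hN
      rw [hN]
      simp only [coeff_sub, coeff_C_mul, ih₀, ih₁, coeff_X_mul]
      ring

theorem little_schroeder_linear_hankel_det (n : ℕ)
    (s : ℕ → ℚ)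
    (hs0 : s 0 = 1) (hs1 : s 1 = 1)
    (hs : ∀ m, ((m + 2 + 1 : ℕ) : ℚ) * s (m + 2)
        = 3 * ((2 * (m + 2) - 1 : ℕ) : ℚ) * s (m + 1) - ((m : ℕ) : ℚ) * s m) :
    (Matrix.of fun i j : Fin (n + 1) =>
        Polynomial.C (s ((i : ℕ) + (j : ℕ))) * X
          - Polynomial.C (s ((i : ℕ) + (j : ℕ) + 1))).det
      = Polynomial.C ((Matrix.of fun i j : Fin (n + 1) =>
          s ((i : ℕ) + (j : ℕ))).det)
        * ∑ k ∈ range (n + 2), (-1 : Polynomial ℚ) ^ (n + 1 - k) * X ^ k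
            * Polynomial.C ((∑ j ∈ range (n + 2 - k),
                2 ^ j * (n + 1 - j).choose k * (k + j - 1).choose j : ℕ) : ℚ) := by
  have hq := PowerSeries.littleSchroeder_quadratic s hs0 hs1 fun m => by
    have h := hs m
    rw [show 2 * (m + 2) - 1 = 2 * m + 3 by lia] at h
    push_cast at h
    linear_combination h
  obtain ⟨hmonic, hdeg⟩ := schroederPoly_monic_natDegree (n + 1)
  rw [det_hankel_pencil s (schroederPoly (n + 1)) hmonic (n + 1) hdeg
    fun i hi => momentFunctional_schroederPoly_eq_zero s hs0 hq hi]
  congr 1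
  rw [(schroederPoly (n + 1)).as_sum_range_C_mul_X_pow' (n := n + 2) (by lia)]
  refine sum_congr rfl fun k hk => ?_
  have hk' : k ≤ n + 1 := Nat.lt_succ_iff.mp (mem_range.mp hk)
  have hsign : (-1 : ℚ) ^ (n + 1 + k) = (-1) ^ (n + 1 - k) := by
    rw [show n + 1 + k = n + 1 - k + 2 * k by lia, pow_add, pow_mul]
    simp
  rw [coeff_schroederPoly, coeff_schroederCoeffSeries hk', hsign, C_mul, C_pow, C_neg, C_1]
  ring
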